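/- arXiv:1707.05302 — 6 statements merged into one kernel-verified Lean document; each statement's English description precedes it below -/
import Mathlib

section
/- Let R be a commutative ring and let M• be a bounded cochain complex of finite free R-modules with differentials d. Let u• and v• be chain endomorphisms of M• (families of R-linear maps uⁱ : Mⁱ → Mⁱ with d∘uⁱ = u^{i+1}∘d, and similarly for v•) that are chain homotopic, i.e., there exist R-linear maps hⁱ : Mⁱ → M^{i−1} with uⁱ − vⁱ = d∘hⁱ + h^{i+1}∘d for all i. Then in R[X]: ∏_{i even} det(1 − X·uⁱ) · ∏_{i odd} det(1 − X·vⁱ) = ∏_{i even} det(1 − X·vⁱ) · ∏_{i odd} det(1 − X·uⁱ); equivalently, the alternating products ∏ᵢ det(1 − X·uⁱ)^{(−1)ⁱ} and ∏ᵢ det(1 − X·vⁱ)^{(−1)ⁱ} agree. -/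
namespace Paper

/-- The reversed characteristic polynomial `det (1 - X u)` of an endomorphism of
a finite free module `Fin m → R`. -/
noncomputable def revCharPoly {R : Type*} [CommRing R] {m : ℕ}
    (u : (Fin m → R) →ₗ[R] (Fin m → R)) : Polynomial R :=
  ((1 : Matrix (Fin m) (Fin m) (Polynomial R)) -
    (Polynomial.X : Polynomial R) •
      ((LinearMap.toMatrix (Pi.basisFun R (Fin m)) (Pi.basisFun R (Fin m)) u).map
        Polynomial.C)).det

/-- The matrix `1 - X u` of power series attached to an endomorphism `u`. -/
noncomputable def revCharMatrix {R : Type*} [CommRing R] {m : ℕ}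
    (u : (Fin m → R) →ₗ[R] (Fin m → R)) : Matrix (Fin m) (Fin m) (PowerSeries R) :=
  1 - (PowerSeries.X : PowerSeries R) • (LinearMap.toMatrix' u).map PowerSeries.C

theorem coe_revCharPoly {R : Type*} [CommRing R] {m : ℕ}
    (u : (Fin m → R) →ₗ[R] (Fin m → R)) :
    Polynomial.coeToPowerSeries.ringHom (revCharPoly u) = (revCharMatrix u).det := by
  rw [revCharPoly, RingHom.map_det]
  congr 1
  ext1 i j
  simp [revCharMatrix, LinearMap.toMatrix_eq_toMatrix', Matrix.one_apply, apply_ite]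
  exact mul_comm _ _

theorem isUnit_det_revCharMatrix {R : Type*} [CommRing R] {m : ℕ}
    (u : (Fin m → R) →ₗ[R] (Fin m → R)) : IsUnit (revCharMatrix u).det := by
  rw [PowerSeries.isUnit_iff_constantCoeff, RingHom.map_det]
  have : (PowerSeries.constantCoeff (R := R)).mapMatrix (revCharMatrix u) = 1 := by
    ext i j
    by_cases hij : i = j <;> simp [revCharMatrix, Matrix.one_apply, hij]
  rw [this, Matrix.det_one]
  exact isUnit_one

/-- If `G` and `G'` are invertible and compatible with a differential, then subtracting a
null-homotopic map from `G` multiplies its determinant by two factors, each depending on only one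
component of the homotopy. -/
theorem det_sub_nullHomotopic {A k l m : Type*} [CommRing A]
    [Fintype k] [DecidableEq k] [Fintype l] [DecidableEq l] [Fintype m] [DecidableEq m]
    (D : Matrix m l A) (D' : Matrix k m A) (H : Matrix l m A) (H' : Matrix m k A)
    (G : Matrix m m A) (G' : Matrix k k A) (hG : IsUnit G.det) (hG' : IsUnit G'.det)
    (hDD : D' * D = 0) (hDG : D' * G = G' * D') :
    (G - (D * H + H' * D')).det =
      (1 - D * (H * G⁻¹)).det * (1 - D' * (H' * G'⁻¹)).det * G.det := by
  have hinv : G'⁻¹ * D' * G = D' := by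
    rw [Matrix.mul_assoc, hDG, Matrix.nonsing_inv_mul_cancel_left _ _ hG']
  have hfac : G - (D * H + H' * D') =
      (1 - H' * G'⁻¹ * D') * (1 - D * (H * G⁻¹)) * G := by
    have h₁ : H' * G'⁻¹ * D' * (D * (H * G⁻¹)) = 0 := by
      rw [Matrix.mul_assoc, ← Matrix.mul_assoc D', hDD, Matrix.zero_mul, Matrix.mul_zero]
    have h₂ : D * (H * G⁻¹) * G = D * H := by
      rw [Matrix.mul_assoc, Matrix.nonsing_inv_mul_cancel_right _ _ hG]
    have h₃ : H' * G'⁻¹ * D' * G = H' * D' := by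
      rw [Matrix.mul_assoc H', Matrix.mul_assoc H', hinv]
    rw [Matrix.sub_mul, Matrix.one_mul, Matrix.mul_sub, Matrix.mul_one, h₁, sub_zero,
      Matrix.sub_mul, Matrix.sub_mul, Matrix.one_mul, h₂, h₃]
    abel
  rw [hfac, Matrix.det_mul, Matrix.det_mul, Matrix.det_one_sub_mul_comm (H' * G'⁻¹) D']
  ring

theorem prod_range_ite_even_telescope {A : Type*} [CommMonoid A] (a b p : ℤ → A)
    (hab : ∀ i, a (i + 1) = p i * p (i + 1) * b (i + 1)) (s : ℤ) (hs : p s = 1) (k : ℕ) :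
    (∏ j ∈ Finset.range k, if Even (s + j + 1) then a (s + j + 1) else b (s + j + 1)) *
        (if Even (s + k) then 1 else p (s + k)) =
      (∏ j ∈ Finset.range k, if Even (s + j + 1) then b (s + j + 1) else a (s + j + 1)) *
        (if Even (s + k) then p (s + k) else 1) := by
  induction k with
  | zero => simp [hs]
  | succ k ih =>
    rw [Finset.prod_range_succ, Finset.prod_range_succ, Nat.cast_succ, ← add_assoc, hab]
    by_cases hk : Even (s + k)
    · have hk' : ¬ Even (s + k + 1) := by simpa [Int.even_add_one] using hk
      simp only [hk, hk', if_true, if_false, mul_one] at ih ⊢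
      rw [ih]
      ac_rfl
    · have hk' : Even (s + k + 1) := by simpa [Int.even_add_one] using hk
      simp only [hk, hk', if_true, if_false, mul_one] at ih ⊢
      rw [← ih]
      ac_rfl

theorem prod_Icc_ite_even_telescope {A : Type*} [CommMonoid A] (a b p : ℤ → A)
    (hab : ∀ i, a (i + 1) = p i * p (i + 1) * b (i + 1)) (N : ℕ)
    (hlow : p (-(N : ℤ) - 1) = 1) (hhigh : p N = 1) :
    (∏ i ∈ Finset.Icc (-(N : ℤ)) N, if Even i then a i else b i) =
      ∏ i ∈ Finset.Icc (-(N : ℤ)) N, if Even i then b i else a i := by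
  have reindex (f : ℤ → A) : ∏ i ∈ Finset.Icc (-(N : ℤ)) N, f i =
      ∏ j ∈ Finset.range (2 * N + 1), f (-(N : ℤ) - 1 + j + 1) := by
    symm
    refine Finset.prod_bij (fun j _ => -(N : ℤ) - 1 + j + 1) ?_ ?_ ?_ (fun _ _ => rfl)
    · intro j hj
      simp only [Finset.mem_range, Finset.mem_Icc] at hj ⊢
      omega
    · intro i _ j _ hij
      omega
    · intro i hi
      rw [Finset.mem_Icc] at hi
      exact ⟨(i + N).toNat, by rw [Finset.mem_range]; omega, by omega⟩
  have key := prod_range_ite_even_telescope a b p hab _ hlow (2 * N + 1)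
  have hend : -(N : ℤ) - 1 + ((2 * N + 1 : ℕ) : ℤ) = N := by push_cast; ring
  rw [hend, hhigh, ite_self, mul_one, mul_one] at key
  rw [reindex, reindex]
  exact key

/-- Let `M•` be a bounded cochain complex of finite free `R`-modules and
let `u•`, `v•` be chain endomorphisms of `M•` that are chain homotopic.  Then
`∏_{i even} det (1 - X uⁱ) ∏_{i odd} det (1 - X vⁱ)
  = ∏_{i even} det (1 - X vⁱ) ∏_{i odd} det (1 - X uⁱ)`,
i.e. the alternating products `∏ᵢ det (1 - X uⁱ)^((-1)^i)` and
`∏ᵢ det (1 - X vⁱ)^((-1)^i)` agree. -/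
theorem statement9 (R : Type*) [CommRing R] (n : ℤ → ℕ) (N : ℕ)
    (hbd : ∀ i : ℤ, (N : ℤ) < |i| → n i = 0)
    (d : ∀ i : ℤ, (Fin (n i) → R) →ₗ[R] (Fin (n (i + 1)) → R))
    (hdd : ∀ i : ℤ, (d (i + 1)).comp (d i) = 0)
    (u v : ∀ i : ℤ, (Fin (n i) → R) →ₗ[R] (Fin (n i) → R))
    (hu : ∀ i : ℤ, (d i).comp (u i) = (u (i + 1)).comp (d i))
    (hv : ∀ i : ℤ, (d i).comp (v i) = (v (i + 1)).comp (d i))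
    (h : ∀ i : ℤ, (Fin (n (i + 1)) → R) →ₗ[R] (Fin (n i) → R))
    (hh : ∀ i : ℤ, u (i + 1) - v (i + 1) = (d i).comp (h i) + (h (i + 1)).comp (d (i + 1))) :
    (∏ i ∈ Finset.Icc (-(N : ℤ)) (N : ℤ),
        if Even i then revCharPoly (u i) else revCharPoly (v i)) =
    ∏ i ∈ Finset.Icc (-(N : ℤ)) (N : ℤ),
        if Even i then revCharPoly (v i) else revCharPoly (u i) := by
  let M {k l : ℕ} (f : (Fin k → R) →ₗ[R] (Fin l → R)) :
      Matrix (Fin l) (Fin k) (PowerSeries R) := (LinearMap.toMatrix' f).map PowerSeries.C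
  have M_comp {k l m : ℕ} (f : (Fin l → R) →ₗ[R] (Fin m → R))
      (g : (Fin k → R) →ₗ[R] (Fin l → R)) : M (f.comp g) = M f * M g := by
    simp only [M, LinearMap.toMatrix'_comp, Matrix.map_mul]
  let H (i : ℤ) := (PowerSeries.X : PowerSeries R) • M (h i)
  let p (i : ℤ) := (1 - M (d i) * (H i * (revCharMatrix (v (i + 1)))⁻¹)).det
  have hDD (i : ℤ) : M (d (i + 1)) * M (d i) = 0 := by
    rw [← M_comp, hdd]
    ext
    simp [M]
  have hDG (i : ℤ) : M (d i) * revCharMatrix (v i) = revCharMatrix (v (i + 1)) * M (d i) := by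
    change M (d i) * (1 - PowerSeries.X • M (v i)) = (1 - PowerSeries.X • M (v (i + 1))) * M (d i)
    rw [Matrix.mul_sub, Matrix.sub_mul, Matrix.mul_smul, Matrix.smul_mul, ← M_comp, ← M_comp, hv,
      Matrix.mul_one, Matrix.one_mul]
  have hstep (i : ℤ) : (revCharMatrix (u (i + 1))).det =
      p i * p (i + 1) * (revCharMatrix (v (i + 1))).det := by
    rw [← det_sub_nullHomotopic (M (d i)) (M (d (i + 1))) (H i) (H (i + 1)) _ _
      (isUnit_det_revCharMatrix _) (isUnit_det_revCharMatrix _) (hDD i) (hDG (i + 1))]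
    congr 1
    have hM : M (u (i + 1)) =
        M (v (i + 1)) + (M (d i) * M (h i) + M (h (i + 1)) * M (d (i + 1))) := by
      rw [← M_comp, ← M_comp, sub_eq_iff_eq_add'.mp (hh i)]
      ext1
      simp [M]
    change 1 - PowerSeries.X • M (u (i + 1)) = 1 - PowerSeries.X • M (v (i + 1)) - _
    rw [hM, Matrix.mul_smul, Matrix.smul_mul, ← smul_add, smul_add _ (M (v (i + 1)))]
    abel
  have hlow : p (-(N : ℤ) - 1) = 1 := by
    have : IsEmpty (Fin (n (-(N : ℤ) - 1))) := by
      rw [hbd _ (by rw [lt_abs]; omega)]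
      infer_instance
    simp only [p]
    rw [Matrix.det_one_sub_mul_comm, Matrix.det_isEmpty]
  have hhigh : p N = 1 := by
    have : IsEmpty (Fin (n ((N : ℤ) + 1))) := by
      rw [hbd _ (by rw [lt_abs]; omega)]
      infer_instance
    exact Matrix.det_isEmpty
  have hinj : Function.Injective (Polynomial.coeToPowerSeries.ringHom (R := R)) :=
    Polynomial.coe_injective R
  apply hinj
  simp only [map_prod, apply_ite (Polynomial.coeToPowerSeries.ringHom (R := R)), coe_revCharPoly]
  exact prod_Icc_ite_even_telescope (fun i => (revCharMatrix (u i)).det)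
    (fun i => (revCharMatrix (v i)).det) p hstep N hlow hhigh

end Paper
end

section
/- Let p be a prime, k ≥ 1, and let n, m₁, …, m_k be nonnegative integers with m₁ + ⋯ + m_k ≤ n. Then v_p(n!) − Σ_{i=1}^k v_p(mᵢ!) ≥ ⌊(n − Σ_{i=1}^k mᵢ)/p⌋, where v_p denotes the p-adic valuation. -/
namespace Paper

theorem padicValNat_factorial_add_le (p : ℕ) [Fact p.Prime] (a b : ℕ) :
    padicValNat p a.factorial + padicValNat p b.factorial ≤ padicValNat p (a + b).factorial := by
  rw [← padicValNat.mul a.factorial_ne_zero b.factorial_ne_zero]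
  exact (padicValNat_dvd_iff_le (a + b).factorial_ne_zero).1
    (pow_padicValNat_dvd.trans (Nat.factorial_mul_factorial_dvd_factorial_add a b))

theorem sum_padicValNat_factorial_le (p : ℕ) [Fact p.Prime] {ι : Type*} (s : Finset ι)
    (m : ι → ℕ) :
    ∑ i ∈ s, padicValNat p (m i).factorial ≤ padicValNat p (∑ i ∈ s, m i).factorial := by
  classical
  induction s using Finset.induction_on with
  | empty => simp
  | insert i s hi ih =>
    rw [Finset.sum_insert hi, Finset.sum_insert hi]
    exact (Nat.add_le_add_left ih _).trans (padicValNat_factorial_add_le p _ _)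

theorem div_le_padicValNat_factorial (p : ℕ) [Fact p.Prime] (d : ℕ) :
    d / p ≤ padicValNat p d.factorial := by
  rw [← padicValNat_mul_div_factorial, padicValNat_factorial_mul]
  exact Nat.le_add_left _ _

/-- Let `p` be a prime, `k ≥ 1`, and `n, m₁, …, m_k` nonnegative
integers with `m₁ + ⋯ + m_k ≤ n`.  Then
`v_p(n!) - ∑ᵢ v_p(mᵢ!) ≥ ⌊(n - ∑ᵢ mᵢ) / p⌋`. -/
theorem statement13 (p : ℕ) (hp : p.Prime) (k : ℕ) (hk : 1 ≤ k) (n : ℕ)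
    (m : Fin k → ℕ) (hm : ∑ i, m i ≤ n) :
    ((n : ℤ) - ∑ i, (m i : ℤ)) / (p : ℤ) ≤
      (padicValNat p (Nat.factorial n) : ℤ) - ∑ i, (padicValNat p (Nat.factorial (m i)) : ℤ) := by
  have : Fact p.Prime := ⟨hp⟩
  obtain ⟨d, rfl⟩ := Nat.exists_eq_add_of_le hm
  have hsum := sum_padicValNat_factorial_le p Finset.univ m
  have hadd := padicValNat_factorial_add_le p (∑ i, m i) d
  have hdiv := div_le_padicValNat_factorial p d
  have hd : ((∑ i, m i + d : ℕ) : ℤ) - ∑ i, (m i : ℤ) = d := by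
    push_cast
    ring
  rw [hd, le_sub_iff_add_le]
  exact_mod_cast (by omega :
    d / p + ∑ i, padicValNat p (m i).factorial ≤ padicValNat p (∑ i, m i + d).factorial)

end Paper
end

section
/- Let p be a prime and n a nonnegative integer. Let g_n : ℤ_p → ℤ_p be the continuous function z ↦ binom(pz, n), where binom(·,n) is the continuous extension to ℤ_p of the binomial-coefficient polynomial, and let g_{nm} = (Δ^m g_n)(0) ∈ ℤ_p (m ∈ ℕ) be its Mahler coefficients, where (Δf)(z) = f(z+1) − f(z). Then for all m, v_p(g_{nm}) ≥ v_p(m!) − v_p(⌊n/p⌋!). -/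
namespace Paper

/-- The one-variable difference operator `(Δ f)(z) = f (z + 1) - f z`. -/
def delta1 {R : Type*} [Ring R] (f : R → R) : R → R :=
  fun z => f (z + 1) - f z

section

open Polynomial

theorem delta1_iterate_eq_fwdDiff {R : Type*} [Ring R] (f : R → R) (m : ℕ) :
    delta1^[m] f = (fwdDiff 1)^[m] f := rfl

/-- The `m`-th finite difference at `0` of `z ↦ binom (k z, n)` is the coefficient of `X ^ n` in
`((X + 1) ^ k - 1) ^ m`. -/
theorem delta1_iterate_choose_mul_zero {R : Type*} [CommRing R] [BinomialRing R] (k n m : ℕ) :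
    delta1^[m] (fun z : R => Ring.choose ((k : R) * z) n) 0 =
      (((X + 1 : R[X]) ^ k - 1) ^ m).coeff n := by
  rw [delta1_iterate_eq_fwdDiff, fwdDiff_iter_eq_sum_shift, sub_eq_add_neg, add_pow,
    finsetSum_coeff]
  refine Finset.sum_congr rfl fun i _ => ?_
  have h : ((X + 1 : R[X]) ^ k) ^ i * (-1) ^ (m - i) * (m.choose i : R[X]) =
      C ((-1) ^ (m - i) * (m.choose i : R)) * (X + 1) ^ (k * i) := by
    simp only [C_mul, C_pow, C_neg, C_1, C_eq_natCast, pow_mul]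
    ring
  rw [h, coeff_C_mul, coeff_X_add_one_pow]
  have h2 : (k : R) * (0 + i • 1) = ((k * i : ℕ) : R) := by simp
  simp only [h2, Ring.choose_natCast, zsmul_eq_mul]
  push_cast
  ring

/-- `p ^ v_p(m!)` divides `p ^ v_p(j!) * (p ^ (m - j) * binom (m, j))`. -/
theorem pow_padicValNat_factorial_dvd_mul_choose (p : ℕ) [Fact p.Prime] {m j : ℕ} (hj : j ≤ m) :
    p ^ padicValNat p m.factorial ∣
      p ^ padicValNat p j.factorial * (p ^ (m - j) * m.choose j) := by
  have hv := padicValNat_factorial_le (p := p) (m - j)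
  rw [← Nat.choose_mul_factorial_mul_factorial hj,
    padicValNat.mul (mul_ne_zero (Nat.choose_pos hj).ne' j.factorial_ne_zero)
      (m - j).factorial_ne_zero,
    padicValNat.mul (Nat.choose_pos hj).ne' j.factorial_ne_zero, pow_add, pow_add, mul_assoc,
    mul_left_comm, mul_comm (p ^ padicValNat p (m.choose j))]
  exact mul_dvd_mul_left _ (mul_dvd_mul (pow_dvd_pow p hv) pow_padicValNat_dvd)

/-- The coefficients of `((X + 1) ^ p - 1) ^ m` are divisible by `p ^ (v_p(m!) - v_p(⌊n/p⌋!))`. -/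
theorem pow_padicValNat_factorial_dvd_coeff {R : Type*} [CommRing R] (p : ℕ) [Fact p.Prime]
    (n m : ℕ) :
    (p : R) ^ padicValNat p m.factorial ∣
      (p : R) ^ padicValNat p (n / p).factorial * (((X + 1 : R[X]) ^ p - 1) ^ m).coeff n := by
  have hp : p.Prime := Fact.out
  obtain ⟨r, hr⟩ := exists_add_pow_prime_eq hp (X : R[X]) 1
  have hr' : (X + 1 : R[X]) ^ p - 1 = X ^ p + (p : R[X]) * (X * r) := by
    rw [hr, one_pow]
    ring
  rw [hr', add_pow, finsetSum_coeff, Finset.mul_sum]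
  refine Finset.dvd_sum fun j hj => ?_
  have hjm : j ≤ m := Nat.lt_succ_iff.mp (Finset.mem_range.mp hj)
  have h : (X ^ p : R[X]) ^ j * ((p : R[X]) * (X * r)) ^ (m - j) * (m.choose j : R[X]) =
      C ((p ^ (m - j) * m.choose j : ℕ) : R) * (X ^ (p * j) * (X * r) ^ (m - j)) := by
    simp only [C_eq_natCast]
    push_cast
    ring
  rw [h, coeff_C_mul, coeff_X_pow_mul']
  split_ifs with hn
  · have hjn : j ≤ n / p := (Nat.le_div_iff_mul_le hp.pos).mpr (by rwa [mul_comm])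
    have hle : padicValNat p j.factorial ≤ padicValNat p (n / p).factorial :=
      (padicValNat_dvd_iff_le (n / p).factorial_ne_zero).mp
        (pow_padicValNat_dvd.trans (Nat.factorial_dvd_factorial hjn))
    have hd := (pow_padicValNat_factorial_dvd_mul_choose p hjm).trans
      (mul_dvd_mul_right (pow_dvd_pow p hle) _)
    rw [← mul_assoc]
    exact Dvd.dvd.mul_right (by exact_mod_cast Nat.cast_dvd_cast (α := R) hd) _
  · simp

end

/-- Let `g_n : ℤ_p → ℤ_p` be `z ↦ binom (p z, n)` and let
`g_{nm} = (Δ^m g_n)(0)` be its Mahler coefficients.  Then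
`v_p(g_{nm}) ≥ v_p(m!) - v_p(⌊n/p⌋!)`, stated as the divisibility
`p^{v_p(m!)} ∣ p^{v_p(⌊n/p⌋!)} · g_{nm}` in `ℤ_p`. -/
theorem statement14 (p : ℕ) [Fact p.Prime] (n m : ℕ) :
    (p : ℤ_[p]) ^ padicValNat p (Nat.factorial m) ∣
      (p : ℤ_[p]) ^ padicValNat p (Nat.factorial (n / p)) *
        (delta1^[m] (fun z : ℤ_[p] => Ring.choose ((p : ℤ_[p]) * z) n)) 0 := by
  rw [delta1_iterate_choose_mul_zero]
  exact pow_padicValNat_factorial_dvd_coeff p n m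

end Paper
end

section
/- Let p be a prime and n a nonnegative integer. Let h : ℤ_p → ℤ_p be the function with h(z) = z/p for z ∈ pℤ_p and h(z) = 0 for z ∈ ℤ_p \ pℤ_p, let h_n : ℤ_p → ℤ_p be the continuous function z ↦ binom(h(z), n) (binom(·,n) the continuous extension of the binomial-coefficient polynomial), and let h_{nm} = (Δ^m h_n)(0) ∈ ℤ_p (m ∈ ℕ) be its Mahler coefficients, where (Δf)(z) = f(z+1) − f(z). Then for all m, v_p(h_{nm}) ≥ v_p(⌊m/p⌋!) − v_p(n!). -/
open scoped Classical

namespace Paper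

/-- The function `h : ℤ_p → ℤ_p` with `h z = z / p` for `z ∈ p ℤ_p` and `h z = 0`
otherwise. -/
noncomputable def divp (p : ℕ) [Fact p.Prime] (z : ℤ_[p]) : ℤ_[p] :=
  if hz : ∃ c : ℤ_[p], z = (p : ℤ_[p]) * c then hz.choose else 0

/-- The difference operator as a linear endomorphism of the space of functions `R → R`. -/
def deltaLin (R : Type*) [CommRing R] : Module.End R (R → R) where
  toFun := delta1
  map_add' f g := by
    ext z
    simp only [delta1, Pi.add_apply]
    ring
  map_smul' c f := by
    ext z
    simp only [delta1, Pi.smul_apply, smul_eq_mul, RingHom.id_apply]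
    ring

lemma deltaLin_pow_apply {R : Type*} [CommRing R] (m : ℕ) (f : R → R) :
    (deltaLin R ^ m) f = delta1^[m] f :=
  Module.End.pow_apply _ _ _

lemma deltaLin_add_one_pow_apply {R : Type*} [CommRing R] (k : ℕ) (f : R → R) (z : R) :
    ((deltaLin R + 1) ^ k) f z = f (z + k) := by
  induction k generalizing z with
  | zero => simp
  | succ k ih =>
    rw [pow_succ', Module.End.mul_apply]
    simp only [LinearMap.add_apply, Module.End.one_apply, Pi.add_apply, deltaLin,
      LinearMap.coe_mk, AddHom.coe_mk, delta1, sub_add_cancel]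
    refine (ih (z + 1)).trans ?_
    push_cast
    ring_nf

lemma delta1_iterate_succ_const {R : Type*} [Ring R] (c : R) (m : ℕ) :
    delta1^[m + 1] (fun _ : R => c) = 0 := by
  induction m with
  | zero =>
    ext z
    simp [delta1]
  | succ m ih =>
    rw [Function.iterate_succ_apply', ih]
    ext z
    simp [delta1]

section

open Polynomial

variable {p : ℕ} [Fact p.Prime]

lemma natCast_p_ne_zero : (p : ℤ_[p]) ≠ 0 :=
  Nat.cast_ne_zero.mpr (Fact.out : p.Prime).ne_zero

lemma divp_mul (c : ℤ_[p]) : divp p (p * c) = c := by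
  have hz : ∃ d : ℤ_[p], (p : ℤ_[p]) * c = p * d := ⟨c, rfl⟩
  rw [divp, dif_pos hz]
  exact (mul_left_cancel₀ natCast_p_ne_zero hz.choose_spec).symm

lemma divp_of_not_dvd {z : ℤ_[p]} (hz : ¬ (p : ℤ_[p]) ∣ z) : divp p z = 0 :=
  dif_neg hz

variable (p) in
/-- The function `z ↦ binom (z / p, n)` on `p ℤ_p`, extended by zero. -/
noncomputable def chooseDiv (n : ℕ) (z : ℤ_[p]) : ℤ_[p] :=
  if (p : ℤ_[p]) ∣ z then Ring.choose (divp p z) n else 0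

lemma chooseDiv_mul (n : ℕ) (c : ℤ_[p]) : chooseDiv p n (p * c) = Ring.choose c n := by
  rw [chooseDiv, if_pos (dvd_mul_right _ _), divp_mul]

lemma chooseDiv_of_not_dvd (n : ℕ) {z : ℤ_[p]} (hz : ¬ (p : ℤ_[p]) ∣ z) :
    chooseDiv p n z = 0 :=
  if_neg hz

lemma chooseDiv_succ (n : ℕ) :
    (fun z => Ring.choose (divp p z) (n + 1)) = chooseDiv p (n + 1) := by
  ext1 z
  by_cases hz : (p : ℤ_[p]) ∣ z
  · rw [chooseDiv, if_pos hz]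
  · rw [chooseDiv_of_not_dvd _ hz, divp_of_not_dvd hz, Ring.choose_zero_succ]

lemma chooseDiv_add_p_zero (z : ℤ_[p]) : chooseDiv p 0 (z + p) = chooseDiv p 0 z := by
  simp [chooseDiv]

lemma chooseDiv_add_p_succ (n : ℕ) (z : ℤ_[p]) :
    chooseDiv p (n + 1) (z + p) = chooseDiv p n z + chooseDiv p (n + 1) z := by
  by_cases hz : (p : ℤ_[p]) ∣ z
  · obtain ⟨c, rfl⟩ := hz
    rw [← mul_add_one, chooseDiv_mul, chooseDiv_mul, chooseDiv_mul, Ring.choose_succ_succ]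
  · rw [chooseDiv_of_not_dvd _ hz, chooseDiv_of_not_dvd _ hz, chooseDiv_of_not_dvd, add_zero]
    rwa [dvd_add_self_right]

variable (p) in
/-- The operator `f ↦ f (· + p) - f`, as a polynomial in the difference operator. -/
noncomputable def shiftPoly : ℤ_[p][X] := (X + 1) ^ p - 1

lemma aeval_shiftPoly_apply (f : ℤ_[p] → ℤ_[p]) (z : ℤ_[p]) :
    aeval (deltaLin ℤ_[p]) (shiftPoly p) f z = f (z + p) - f z := by
  simp only [shiftPoly, map_sub, map_pow, map_add, aeval_X, map_one, LinearMap.sub_apply,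
    Module.End.one_apply, Pi.sub_apply, deltaLin_add_one_pow_apply]

lemma aeval_shiftPoly_chooseDiv_zero :
    aeval (deltaLin ℤ_[p]) (shiftPoly p) (chooseDiv p 0) = 0 := by
  ext1 z
  rw [aeval_shiftPoly_apply, chooseDiv_add_p_zero, sub_self, Pi.zero_apply]

lemma aeval_shiftPoly_chooseDiv_succ (n : ℕ) :
    aeval (deltaLin ℤ_[p]) (shiftPoly p) (chooseDiv p (n + 1)) = chooseDiv p n := by
  ext1 z
  rw [aeval_shiftPoly_apply, chooseDiv_add_p_succ, add_sub_cancel_right]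

lemma aeval_shiftPoly_pow_chooseDiv {n i : ℕ} (h : n < i) :
    aeval (deltaLin ℤ_[p]) (shiftPoly p ^ i) (chooseDiv p n) = 0 := by
  induction i generalizing n with
  | zero => omega
  | succ i ih =>
    rw [pow_succ, map_mul, Module.End.mul_apply]
    cases n with
    | zero => rw [aeval_shiftPoly_chooseDiv_zero, map_zero]
    | succ n => rw [aeval_shiftPoly_chooseDiv_succ, ih (by omega)]

lemma associated_natCast {k : ℕ} (hk : k ≠ 0) :
    Associated ((p : ℤ_[p]) ^ padicValNat p k) (k : ℤ_[p]) := by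
  have hk' : (k : ℤ_[p]) ≠ 0 := Nat.cast_ne_zero.mpr hk
  have hv : (k : ℤ_[p]).valuation = padicValNat p k := by
    have h := PadicInt.valuation_coe (k : ℤ_[p])
    rw [PadicInt.coe_natCast, Padic.valuation_natCast] at h
    exact_mod_cast h.symm
  refine ⟨PadicInt.unitCoeff hk', ?_⟩
  rw [mul_comm, ← hv]
  exact (PadicInt.unitCoeff_spec hk').symm

lemma factorial_dvd_p_pow (k : ℕ) : (k.factorial : ℤ_[p]) ∣ (p : ℤ_[p]) ^ k := by
  refine (associated_natCast k.factorial_ne_zero).symm.dvd.trans (pow_dvd_pow _ ?_)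
  have hp := (Fact.out : p.Prime).two_le
  calc padicValNat p k.factorial ≤ (p - 1) * padicValNat p k.factorial :=
        Nat.le_mul_of_pos_left _ (by omega)
    _ = k - (p.digits k).sum := sub_one_mul_padicValNat_factorial k
    _ ≤ k := Nat.sub_le _ _

lemma factorial_dvd_factorial_mul_choose_mul_pow {n i M : ℕ} (hin : i ≤ n) (hiM : i ≤ M) :
    (M.factorial : ℤ_[p]) ∣ n.factorial * (M.choose i * (p : ℤ_[p]) ^ (M - i)) := by
  rw [← Nat.choose_mul_factorial_mul_factorial hiM]
  push_cast
  rw [mul_comm (M.choose i : ℤ_[p]), mul_assoc]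
  exact mul_dvd_mul (Nat.cast_dvd_cast (Nat.factorial_dvd_factorial hin))
    (mul_dvd_mul_left _ (factorial_dvd_p_pow _))

lemma factorial_dvd_delta1_iterate_chooseDiv (n m : ℕ) (z : ℤ_[p]) :
    ((m / p).factorial : ℤ_[p]) ∣ n.factorial * delta1^[m] (chooseDiv p n) z := by
  obtain ⟨V, hV⟩ := exists_add_pow_prime_eq (Fact.out : p.Prime) (X : ℤ_[p][X]) 1
  have hX : (X : ℤ_[p][X]) ^ p = shiftPoly p + C (p : ℤ_[p]) * (-(X * V)) := by
    rw [shiftPoly, hV, map_natCast]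
    ring
  have hm : (X : ℤ_[p][X]) ^ m = ∑ i ∈ Finset.range (m / p + 1),
      C ((m / p).choose i * (p : ℤ_[p]) ^ (m / p - i)) *
        (X ^ (m % p) * (-(X * V)) ^ (m / p - i) * shiftPoly p ^ i) := by
    conv_lhs => rw [← Nat.mod_add_div m p, pow_add, pow_mul, hX, add_pow, Finset.mul_sum]
    refine Finset.sum_congr rfl fun i _ => ?_
    rw [mul_pow, map_mul, map_pow, map_natCast, map_natCast]
    ring
  have hD : delta1^[m] (chooseDiv p n) =
      aeval (deltaLin ℤ_[p]) (X ^ m : ℤ_[p][X]) (chooseDiv p n) := by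
    rw [map_pow, aeval_X, deltaLin_pow_apply]
  rw [hD, hm, map_sum, LinearMap.sum_apply, Finset.sum_apply, Finset.mul_sum]
  refine Finset.dvd_sum fun i hi => ?_
  rw [← smul_eq_C_mul, map_smul, LinearMap.smul_apply, Pi.smul_apply, smul_eq_mul, ← mul_assoc]
  rcases le_or_gt i n with hin | hin
  · exact (factorial_dvd_factorial_mul_choose_mul_pow hin
      (Finset.mem_range_succ_iff.mp hi)).mul_right _
  · rw [map_mul, Module.End.mul_apply, aeval_shiftPoly_pow_chooseDiv hin, map_zero,
      Pi.zero_apply, mul_zero]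
    exact dvd_zero _

end

/-- Let `h_n : ℤ_p → ℤ_p` be `z ↦ binom (h z, n)` where `h z = z/p` on
`p ℤ_p` and `0` elsewhere, and let `h_{nm} = (Δ^m h_n)(0)` be its Mahler coefficients.
Then `v_p(h_{nm}) ≥ v_p(⌊m/p⌋!) - v_p(n!)`, stated as the divisibility
`p^{v_p(⌊m/p⌋!)} ∣ p^{v_p(n!)} · h_{nm}` in `ℤ_p`. -/
theorem statement15 (p : ℕ) [Fact p.Prime] (n m : ℕ) :
    (p : ℤ_[p]) ^ padicValNat p (Nat.factorial (m / p)) ∣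
      (p : ℤ_[p]) ^ padicValNat p (Nat.factorial n) *
        (delta1^[m] (fun z : ℤ_[p] => Ring.choose (divp p z) n)) 0 := by
  rw [(associated_natCast (m / p).factorial_ne_zero).dvd_iff_dvd_left,
    ((associated_natCast n.factorial_ne_zero).mul_right _).dvd_iff_dvd_right]
  cases n with
  | zero =>
    simp only [Ring.choose_zero_right]
    cases m with
    | zero => simp
    | succ m => simp [delta1_iterate_succ_const]
  | succ n =>
    rw [chooseDiv_succ]
    exact factorial_dvd_delta1_iterate_chooseDiv _ _ _

end Paper
end

section
/- Let S be a finite set, let σ : S → S satisfy σ∘σ = id, and let a, b : S → ℝ satisfy a(σx) = −b(x) and b(σx) = −a(x) for all x ∈ S. Assume a(x) ≠ 0 and a(x) + b(x) ≠ 0 for all x ∈ S. Then the number of x ∈ S with a(x) < 0 < b(x) equals twice the number of x ∈ S with a(x) < 0 < a(x) + b(x). -/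
open scoped Classical

namespace Paper

/-- Let `S` be a finite set, `σ : S → S` an involution, and
`a, b : S → ℝ` with `a (σ x) = -b x` and `b (σ x) = -a x`.  If `a x ≠ 0` and
`a x + b x ≠ 0` for all `x`, then
`#{x : a x < 0 < b x} = 2 · #{x : a x < 0 < a x + b x}`. -/
theorem statement16 (S : Type*) [Fintype S] (σ : S → S) (hσ : σ ∘ σ = id)
    (a b : S → ℝ) (ha : ∀ x, a (σ x) = -b x) (hb : ∀ x, b (σ x) = -a x)
    (ha0 : ∀ x, a x ≠ 0) (hab0 : ∀ x, a x + b x ≠ 0) :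
    (Finset.univ.filter fun x : S => a x < 0 ∧ 0 < b x).card =
      2 * (Finset.univ.filter fun x : S => a x < 0 ∧ 0 < a x + b x).card := by
  have hinv : ∀ x, σ (σ x) = x := congrFun hσ
  have hpos : (Finset.univ.filter fun x : S => a x < 0 ∧ 0 < b x).filter
      (fun x => 0 < a x + b x) = Finset.univ.filter fun x : S => a x < 0 ∧ 0 < a x + b x := by
    ext x
    simp only [Finset.mem_filter, Finset.mem_univ, true_and]
    exact ⟨fun h => ⟨h.1.1, h.2⟩, fun h => ⟨⟨h.1, by linarith [h.1, h.2]⟩, h.2⟩⟩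
  have hneg : ((Finset.univ.filter fun x : S => a x < 0 ∧ 0 < b x).filter
      fun x => ¬ 0 < a x + b x).card =
      (Finset.univ.filter fun x : S => a x < 0 ∧ 0 < a x + b x).card := by
    refine Finset.card_nbij' σ σ ?_ ?_ (fun x _ => hinv x) (fun x _ => hinv x)
    · intro x hx
      simp only [Finset.coe_filter, Finset.mem_filter, Finset.mem_univ, true_and,
        Set.mem_ofPred_eq, ha, hb] at hx ⊢
      have hlt := lt_of_le_of_ne (not_lt.mp hx.2) (hab0 x)
      exact ⟨by linarith [hx.1.2], by linarith⟩
    · intro x hx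
      simp only [Finset.coe_filter, Finset.mem_filter, Finset.mem_univ, true_and,
        Set.mem_ofPred_eq, ha, hb] at hx ⊢
      exact ⟨⟨by linarith [hx.1, hx.2], by linarith [hx.1]⟩, by linarith [hx.2]⟩
  rw [← Finset.card_filter_add_card_filter_not (fun x => 0 < a x + b x), hpos, hneg, two_mul]

end Paper
end

section
/- Let A be a commutative ring, A₀ ⊆ A a subring, and α ∈ A₀ an element invertible in A such that A = A₀[α^{-1}]. Let h be a commutative A-algebra that is generated as an A-module by finitely many elements a₁, …, aₙ. Then there exists ℓ ∈ ℕ such that the A₀-submodule h₀ of h generated by 1, α^ℓa₁, …, α^ℓaₙ is a subring of h. Moreover, if A₀ is Noetherian then h₀ is a Noetherian ring. -/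
namespace Paper

/-- If finitely many elements all become elements of `A₀` after multiplication by some power of
`α ∈ A₀`, then a single power of `α` works for all of them. -/
lemma exists_pow_mul_mem {A ι : Type*} [CommRing A] [Finite ι] (A₀ : Subring A) {α : A}
    (hα : α ∈ A₀) (f : ι → A) (hf : ∀ i, ∃ n : ℕ, α ^ n * f i ∈ A₀) :
    ∃ ℓ : ℕ, ∀ i, α ^ ℓ * f i ∈ A₀ := by
  choose m hm using hf
  obtain ⟨ℓ, hℓ⟩ := (Set.finite_range m).bddAbove
  refine ⟨ℓ, fun i => ?_⟩
  obtain ⟨k, rfl⟩ := Nat.exists_eq_add_of_le' (hℓ (Set.mem_range_self i))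
  rw [pow_add, mul_assoc]
  exact mul_mem (pow_mem hα k) (hm i)

/-- The span of `1` and a family `b` is a subalgebra as soon as it contains all products
`b i * b j`. -/
def spanInsertOneRange (R : Type*) {S ι : Type*} [CommRing R] [CommRing S] [Algebra R S]
    (b : ι → S) (hb : ∀ i j, b i * b j ∈ Submodule.span R (insert 1 (Set.range b))) :
    Subalgebra R S :=
  (Submodule.span R (insert 1 (Set.range b))).toSubalgebra
    (Submodule.subset_span (Set.mem_insert _ _)) <| by
      suffices Submodule.span R (insert 1 (Set.range b)) * Submodule.span R (insert 1 (Set.range b))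
          ≤ Submodule.span R (insert 1 (Set.range b)) from
        fun x y hx hy => this (Submodule.mul_mem_mul hx hy)
      rw [Submodule.span_mul_span, Submodule.span_le]
      rintro _ ⟨x, hx, y, hy, rfl⟩
      rcases hx with rfl | ⟨i, rfl⟩
      · simpa using Submodule.subset_span hy
      · rcases hy with rfl | ⟨j, rfl⟩
        · simpa using Submodule.subset_span (Set.mem_insert_of_mem _ (Set.mem_range_self i))
        · exact hb i j

/-- Let `A` be a commutative ring, `A₀ ⊆ A` a subring, and `α ∈ A₀`
invertible in `A` with `A = A₀[α⁻¹]`.  Let `h` be a commutative `A`-algebra generated as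
an `A`-module by `a₁, …, aₙ`.  Then there is `ℓ ∈ ℕ` such that the `A₀`-submodule `h₀`
generated by `1, α^ℓ a₁, …, α^ℓ aₙ` is a subring of `h`; moreover if `A₀` is Noetherian
then `h₀` is a Noetherian ring. -/
theorem statement18 (A : Type*) [CommRing A] (A₀ : Subring A) (α : A)
    (hα : α ∈ A₀) (hu : IsUnit α)
    (hloc : ∀ a : A, ∃ n : ℕ, α ^ n * a ∈ A₀)
    (h : Type*) [CommRing h] [Algebra A h] (n : ℕ) (a : Fin n → h)
    (hgen : Submodule.span A (Set.range a) = ⊤) :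
    ∃ (ℓ : ℕ) (h₀ : Subring h),
      (∀ x : h, x ∈ h₀ ↔ ∃ c₀ ∈ A₀, ∃ c : Fin n → A, (∀ i, c i ∈ A₀) ∧
        x = c₀ • (1 : h) + ∑ i, c i • (α ^ ℓ • a i)) ∧
      (IsNoetherianRing A₀ → IsNoetherianRing h₀) := by
  have hmul (i j : Fin n) : ∃ c : Fin n → A, ∑ k, c k • a k = a i * a j :=
    (Submodule.mem_span_range_iff_exists_fun A).1 (hgen ▸ Submodule.mem_top)
  choose c hc using hmul
  obtain ⟨ℓ, hℓ⟩ := exists_pow_mul_mem A₀ hα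
    (fun p : Fin n × Fin n × Fin n => c p.1 p.2.1 p.2.2) (fun _ => hloc _)
  let b (i : Fin n) : h := α ^ ℓ • a i
  have hb (i j : Fin n) : b i * b j ∈ Submodule.span A₀ (insert 1 (Set.range b)) := by
    have key : b i * b j = ∑ k, (⟨α ^ ℓ * c i j k, hℓ (i, j, k)⟩ : A₀) • b k := by
      simp only [b, Subring.smul_def, smul_mul_smul_comm, ← hc, Finset.smul_sum, smul_smul]
      exact Finset.sum_congr rfl fun k _ => by congr 1; ring
    rw [key]
    exact sum_mem fun k _ => Submodule.smul_mem _ _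
      (Submodule.subset_span (Set.mem_insert_of_mem _ (Set.mem_range_self k)))
  refine ⟨ℓ, (spanInsertOneRange A₀ b hb).toSubring, fun x => ?_, fun _ => ?_⟩
  · change x ∈ Submodule.span A₀ (insert 1 (Set.range b)) ↔ _
    simp only [Submodule.mem_span_insert, Submodule.mem_span_range_iff_exists_fun]
    constructor
    · rintro ⟨c₀, _, ⟨d, rfl⟩, rfl⟩
      exact ⟨c₀, c₀.2, fun i => d i, fun i => (d i).2, rfl⟩
    · rintro ⟨c₀, hc₀, d, hd, rfl⟩
      exact ⟨⟨c₀, hc₀⟩, _, ⟨fun i => ⟨d i, hd i⟩, rfl⟩, rfl⟩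
  · have : Module.Finite A₀ (spanInsertOneRange A₀ b hb) :=
      Module.Finite.span_of_finite A₀ ((Set.finite_range b).insert 1)
    exact IsNoetherianRing.of_finite A₀ (spanInsertOneRange A₀ b hb)

end Paper
end
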